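/- If x* is a strict local-nonglobal minimizer of (GTRE) or of (GTR), then there exists a Lagrangian multiplier μ* ∈ ℝ such that (A₀x* + b₀) + μ*(A₁x* + b₁) = 0 and vᵀ(A₀ + μ*A₁)v > 0 for every nonzero v ∈ ℝⁿ with (A₁x* + b₁)ᵀv = 0 (i.e., the second-order sufficient optimality conditions hold at x*). -/

import Mathlib

open Matrix Finset

/-- Euclidean norm of a vector in `Fin n → ℝ`. -/
noncomputable def euclNorm {n : ℕ} (x : Fin n → ℝ) : ℝ := Real.sqrt (x ⬝ᵥ x)

/-- Objective `f₀(x) = xᵀA₀x + 2b₀ᵀx`. -/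
noncomputable def qf0 {n : ℕ} (A0 : Matrix (Fin n) (Fin n) ℝ) (b0 : Fin n → ℝ)
    (x : Fin n → ℝ) : ℝ := x ⬝ᵥ A0.mulVec x + 2 * (b0 ⬝ᵥ x)

/-- Constraint `f₁(x) = xᵀA₁x + 2b₁ᵀx + c₁`. -/
noncomputable def qf1 {n : ℕ} (A1 : Matrix (Fin n) (Fin n) ℝ) (b1 : Fin n → ℝ) (c1 : ℝ)
    (x : Fin n → ℝ) : ℝ := x ⬝ᵥ A1.mulVec x + 2 * (b1 ⬝ᵥ x) + c1

/-- Local minimizer of (GTRE): feasible, and locally optimal among feasible points. -/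
def IsLocalMinGTRE {n : ℕ} (A0 A1 : Matrix (Fin n) (Fin n) ℝ) (b0 b1 : Fin n → ℝ) (c1 : ℝ)
    (xs : Fin n → ℝ) : Prop :=
  qf1 A1 b1 c1 xs = 0 ∧ ∃ δ > (0:ℝ), ∀ x : Fin n → ℝ,
    qf1 A1 b1 c1 x = 0 → euclNorm (x - xs) < δ → qf0 A0 b0 xs ≤ qf0 A0 b0 x

/-- Global minimizer of (GTRE). -/
def IsGlobalMinGTRE {n : ℕ} (A0 A1 : Matrix (Fin n) (Fin n) ℝ) (b0 b1 : Fin n → ℝ) (c1 : ℝ)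
    (xs : Fin n → ℝ) : Prop :=
  qf1 A1 b1 c1 xs = 0 ∧ ∀ x : Fin n → ℝ, qf1 A1 b1 c1 x = 0 → qf0 A0 b0 xs ≤ qf0 A0 b0 x

/-- Local-nonglobal minimizer of (GTRE). -/
def IsLNGMinGTRE {n : ℕ} (A0 A1 : Matrix (Fin n) (Fin n) ℝ) (b0 b1 : Fin n → ℝ) (c1 : ℝ)
    (xs : Fin n → ℝ) : Prop :=
  IsLocalMinGTRE A0 A1 b0 b1 c1 xs ∧ ¬ IsGlobalMinGTRE A0 A1 b0 b1 c1 xs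

/-- Strict local minimizer of (GTRE). -/
def IsStrictLocalMinGTRE {n : ℕ} (A0 A1 : Matrix (Fin n) (Fin n) ℝ) (b0 b1 : Fin n → ℝ)
    (c1 : ℝ) (xs : Fin n → ℝ) : Prop :=
  qf1 A1 b1 c1 xs = 0 ∧ ∃ δ > (0:ℝ), ∀ x : Fin n → ℝ,
    qf1 A1 b1 c1 x = 0 → x ≠ xs → euclNorm (x - xs) < δ → qf0 A0 b0 xs < qf0 A0 b0 x

/-- Strict local-nonglobal minimizer of (GTRE). -/
def IsStrictLNGMinGTRE {n : ℕ} (A0 A1 : Matrix (Fin n) (Fin n) ℝ) (b0 b1 : Fin n → ℝ)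
    (c1 : ℝ) (xs : Fin n → ℝ) : Prop :=
  IsStrictLocalMinGTRE A0 A1 b0 b1 c1 xs ∧ ¬ IsGlobalMinGTRE A0 A1 b0 b1 c1 xs

/-- Local minimizer of (GTR). -/
def IsLocalMinGTR {n : ℕ} (A0 A1 : Matrix (Fin n) (Fin n) ℝ) (b0 b1 : Fin n → ℝ) (c1 : ℝ)
    (xs : Fin n → ℝ) : Prop :=
  qf1 A1 b1 c1 xs ≤ 0 ∧ ∃ δ > (0:ℝ), ∀ x : Fin n → ℝ,
    qf1 A1 b1 c1 x ≤ 0 → euclNorm (x - xs) < δ → qf0 A0 b0 xs ≤ qf0 A0 b0 x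

/-- Global minimizer of (GTR). -/
def IsGlobalMinGTR {n : ℕ} (A0 A1 : Matrix (Fin n) (Fin n) ℝ) (b0 b1 : Fin n → ℝ) (c1 : ℝ)
    (xs : Fin n → ℝ) : Prop :=
  qf1 A1 b1 c1 xs ≤ 0 ∧ ∀ x : Fin n → ℝ, qf1 A1 b1 c1 x ≤ 0 → qf0 A0 b0 xs ≤ qf0 A0 b0 x

/-- Local-nonglobal minimizer of (GTR). -/
def IsLNGMinGTR {n : ℕ} (A0 A1 : Matrix (Fin n) (Fin n) ℝ) (b0 b1 : Fin n → ℝ) (c1 : ℝ)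
    (xs : Fin n → ℝ) : Prop :=
  IsLocalMinGTR A0 A1 b0 b1 c1 xs ∧ ¬ IsGlobalMinGTR A0 A1 b0 b1 c1 xs

/-- Strict local minimizer of (GTR). -/
def IsStrictLocalMinGTR {n : ℕ} (A0 A1 : Matrix (Fin n) (Fin n) ℝ) (b0 b1 : Fin n → ℝ)
    (c1 : ℝ) (xs : Fin n → ℝ) : Prop :=
  qf1 A1 b1 c1 xs ≤ 0 ∧ ∃ δ > (0:ℝ), ∀ x : Fin n → ℝ,
    qf1 A1 b1 c1 x ≤ 0 → x ≠ xs → euclNorm (x - xs) < δ → qf0 A0 b0 xs < qf0 A0 b0 x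

/-- Strict local-nonglobal minimizer of (GTR). -/
def IsStrictLNGMinGTR {n : ℕ} (A0 A1 : Matrix (Fin n) (Fin n) ℝ) (b0 b1 : Fin n → ℝ)
    (c1 : ℝ) (xs : Fin n → ℝ) : Prop :=
  IsStrictLocalMinGTR A0 A1 b0 b1 c1 xs ∧ ¬ IsGlobalMinGTR A0 A1 b0 b1 c1 xs

open Filter Topology

/-- A function whose product with `t` is nonnegative near `0` tends to `0` at `0`, if it
converges. -/
lemma limit_eq_zero_of_mul_nonneg {φ : ℝ → ℝ} {L : ℝ} (hφ : Tendsto φ (𝓝 0) (𝓝 L))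
    (h : ∀ᶠ t in 𝓝 (0:ℝ), 0 ≤ t * φ t) : L = 0 := by
  have hpos : (𝓝[>] (0:ℝ)) ≤ 𝓝 0 := nhdsWithin_le_nhds
  have hneg : (𝓝[<] (0:ℝ)) ≤ 𝓝 0 := nhdsWithin_le_nhds
  apply le_antisymm
  · refine le_of_tendsto (hφ.mono_left hneg) ?_
    filter_upwards [hneg h, self_mem_nhdsWithin] with t ht (ht0 : t < 0)
    by_contra! hc
    exact absurd ht (not_le.mpr (mul_neg_of_neg_of_pos ht0 hc))
  · refine ge_of_tendsto (hφ.mono_left hpos) ?_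
    filter_upwards [hpos h, self_mem_nhdsWithin] with t ht (ht0 : 0 < t)
    exact nonneg_of_mul_nonneg_right ht ht0

/-- A function whose product with `t ^ 2` is nonnegative for small `t > 0` has a nonnegative
limit at `0`. -/
lemma limit_nonneg_of_sq_mul_nonneg {φ : ℝ → ℝ} {L : ℝ} (hφ : Tendsto φ (𝓝 0) (𝓝 L))
    (h : ∀ᶠ t in 𝓝 (0:ℝ), 0 ≤ t ^ 2 * φ t) : 0 ≤ L := by
  have hpos : (𝓝[>] (0:ℝ)) ≤ 𝓝 0 := nhdsWithin_le_nhds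
  refine ge_of_tendsto (hφ.mono_left hpos) ?_
  filter_upwards [hpos h, self_mem_nhdsWithin] with t ht (ht0 : 0 < t)
  exact nonneg_of_mul_nonneg_right ht (by positivity)

/-- A quadratic without constant term that is nonnegative near `0` is nonnegative at `1`. -/
lemma quadratic_nonneg_of_eventually {q l : ℝ}
    (h : ∀ᶠ t in 𝓝 (0:ℝ), 0 ≤ t ^ 2 * q + 2 * (t * l)) : 0 ≤ q + 2 * l := by
  have hc : Tendsto (fun t : ℝ => t * q + 2 * l) (𝓝 0) (𝓝 (0 * q + 2 * l)) :=
    Continuous.tendsto (by fun_prop) 0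
  have hl := limit_eq_zero_of_mul_nonneg hc (h.mono fun t ht => by linarith)
  have hl0 : l = 0 := by linarith
  subst hl0
  have := limit_nonneg_of_sq_mul_nonneg (tendsto_const_nhds (x := q))
    (h.mono fun t ht => by linarith)
  linarith

/-- The small root `s = t ^ 2 * r t` of `a * s ^ 2 + 2 * s * (1 + b * t) + c * t ^ 2 = 0`. -/
lemma exists_small_root (a b c : ℝ) : ∃ r : ℝ → ℝ, Tendsto r (𝓝 0) (𝓝 (-c / 2)) ∧
    ∀ᶠ t in 𝓝 (0:ℝ),
      a * (t ^ 2 * r t) ^ 2 + 2 * (t ^ 2 * r t) * (1 + b * t) + c * t ^ 2 = 0 := by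
  have hp : Tendsto (fun t : ℝ => 1 + b * t) (𝓝 0) (𝓝 1) := by
    have : Continuous fun t : ℝ => 1 + b * t := by fun_prop
    simpa using this.tendsto 0
  have hq : Tendsto (fun t : ℝ => (1 + b * t) ^ 2 - a * c * t ^ 2) (𝓝 0) (𝓝 1) := by
    have : Continuous fun t : ℝ => (1 + b * t) ^ 2 - a * c * t ^ 2 := by fun_prop
    simpa using this.tendsto 0
  refine ⟨fun t => -c / ((1 + b * t) + √((1 + b * t) ^ 2 - a * c * t ^ 2)), ?_, ?_⟩
  · refine Tendsto.div tendsto_const_nhds ?_ two_ne_zero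
    have := hp.add hq.sqrt
    rw [Real.sqrt_one] at this
    norm_num at this
    exact this
  · filter_upwards [hp.eventually_const_lt one_pos, hq.eventually_const_lt one_pos]
      with t hpt hqt
    have hs := Real.sq_sqrt hqt.le
    have hs0 := Real.sqrt_nonneg ((1 + b * t) ^ 2 - a * c * t ^ 2)
    set s := √((1 + b * t) ^ 2 - a * c * t ^ 2)
    have hD : (1 + b * t) + s ≠ 0 := by positivity
    have hx := div_mul_cancel₀ (-c) hD
    set x := -c / ((1 + b * t) + s)
    have hxs : a * t ^ 2 * x = s - (1 + b * t) :=
      mul_right_cancel₀ hD (by linear_combination a * t ^ 2 * hx - hs)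
    linear_combination t ^ 2 * x * hxs + t ^ 2 * hx

/-- If `β * k < 0` then `β * σ ^ 2 + 2 * t * σ * b + (t ^ 2 * a + 2 * t * k) = 0` has, for small
`t > 0`, a solution `σ` tending to `0` with `t`. -/
lemma exists_vanishing_root {a b k β : ℝ} (hβk : β * k < 0) :
    ∃ σ : ℝ → ℝ, Tendsto σ (𝓝[>] 0) (𝓝 0) ∧
      ∀ᶠ t in 𝓝[>] (0:ℝ), β * σ t ^ 2 + 2 * t * σ t * b + (t ^ 2 * a + 2 * t * k) = 0 := by
  have hβ : β ≠ 0 := by rintro rfl; simp at hβk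
  refine ⟨fun t => (-(t * b) + √(t ^ 2 * b ^ 2 - β * (t ^ 2 * a + 2 * t * k))) / β, ?_, ?_⟩
  · have : Continuous
        fun t : ℝ => (-(t * b) + √(t ^ 2 * b ^ 2 - β * (t ^ 2 * a + 2 * t * k))) / β := by
      fun_prop
    have h0 := this.tendsto 0
    simp only [ne_eq, OfNat.ofNat_ne_zero, not_false_eq_true, zero_pow, zero_mul, mul_zero,
      add_zero, sub_zero, neg_zero, Real.sqrt_zero, zero_div] at h0
    exact h0.mono_left nhdsWithin_le_nhds
  · have hc : Tendsto (fun t : ℝ => t * b ^ 2 - β * (t * a + 2 * k)) (𝓝[>] 0)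
        (𝓝 (-(2 * (β * k)))) := by
      have : Continuous fun t : ℝ => t * b ^ 2 - β * (t * a + 2 * k) := by fun_prop
      have h0 := (this.tendsto 0).mono_left (nhdsWithin_le_nhds (s := Set.Ioi 0))
      convert h0 using 2
      ring
    filter_upwards [hc.eventually_const_lt (show (0:ℝ) < -(2 * (β * k)) by linarith),
      self_mem_nhdsWithin] with t ht (ht0 : 0 < t)
    have hD : 0 ≤ t ^ 2 * b ^ 2 - β * (t ^ 2 * a + 2 * t * k) := by
      have := mul_pos ht0 ht
      linarith
    have hs := Real.sq_sqrt hD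
    set s := √(t ^ 2 * b ^ 2 - β * (t ^ 2 * a + 2 * t * k))
    field_simp
    linear_combination hs

section Quadratic

variable {V : Type*} [NormedAddCommGroup V] [NormedSpace ℝ V]

lemma bilin_comb_self {B : LinearMap.BilinForm ℝ V} (hB : ∀ x y, B x y = B y x)
    (s t : ℝ) (x y : V) :
    B (s • x + t • y) (s • x + t • y) = s ^ 2 * B x x + 2 * s * t * B x y + t ^ 2 * B y y := by
  simp only [map_add, map_smul, LinearMap.add_apply, LinearMap.smul_apply, smul_eq_mul, hB y x]
  ring

/-- First-order necessary condition for minimizing `B₀ d d + 2 l₀ d` near `0` subject to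
`B₁ d d + 2 l₁ d = 0`, where `l₁ ≠ 0`. -/
lemma first_order_necessary {B0 B1 : LinearMap.BilinForm ℝ V} {l0 l1 : V →ₗ[ℝ] ℝ} {e : V}
    (hB0 : ∀ x y, B0 x y = B0 y x) (hB1 : ∀ x y, B1 x y = B1 y x) (he : l1 e = 1)
    (hloc : ∀ᶠ d in 𝓝 (0:V), B1 d d + 2 * l1 d = 0 → 0 ≤ B0 d d + 2 * l0 d)
    (d : V) : l0 d = l0 e * l1 d := by
  have key : ∀ u, l1 u = 0 → l0 u = 0 := by
    intro u hu
    obtain ⟨r, hr, hroot⟩ := exists_small_root (B1 e e) (B1 u e) (B1 u u)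
    have hid : Tendsto (fun t : ℝ => t) (𝓝 0) (𝓝 0) := tendsto_id
    have hγ : Tendsto (fun t : ℝ => t • u + (t ^ 2 * r t) • e) (𝓝 0) (𝓝 (0:V)) := by
      simpa using (hid.smul_const u).add (((hid.pow 2).mul hr).smul_const e)
    have hφ : Tendsto (fun t : ℝ => t * (B0 u u + 2 * t * r t * B0 u e
        + (t * r t) ^ 2 * B0 e e + 2 * r t * l0 e) + 2 * l0 u) (𝓝 0)
        (𝓝 (0 * (B0 u u + 2 * 0 * (-B1 u u / 2) * B0 u e
        + (0 * (-B1 u u / 2)) ^ 2 * B0 e e + 2 * (-B1 u u / 2) * l0 e) + 2 * l0 u)) := by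
      refine (hid.mul ?_).add_const _
      exact (((((hid.const_mul 2).mul hr).mul_const _).const_add _).add
        (((hid.mul hr).pow 2).mul_const _)).add ((hr.const_mul 2).mul_const _)
    have := limit_eq_zero_of_mul_nonneg hφ (by
      filter_upwards [hroot, hγ.eventually hloc] with t h1 h2
      rw [bilin_comb_self hB1, bilin_comb_self hB0] at h2
      simp only [map_add, map_smul, smul_eq_mul, hu, he] at h2
      have := h2 (by linear_combination h1)
      linarith)
    linarith
  have := key (d - l1 d • e) (by simp [he])
  simp only [map_sub, map_smul, smul_eq_mul] at this
  linarith

/-- Second-order analysis of minimizing the quadratic form `H` near `0` subject to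
`B₁ d d + 2 l₁ d = 0`, where `l₁ ≠ 0`: `H` is nonnegative on the tangent space, and a null
vector of `H` there on which `B₁` does not vanish is `H`-orthogonal to the normal vector `e`. -/
lemma second_order_necessary {H B1 : LinearMap.BilinForm ℝ V} {l1 : V →ₗ[ℝ] ℝ} {e : V}
    (hH : ∀ x y, H x y = H y x) (hB1 : ∀ x y, B1 x y = B1 y x) (he : l1 e = 1)
    (hloc : ∀ᶠ d in 𝓝 (0:V), B1 d d + 2 * l1 d = 0 → 0 ≤ H d d)
    {u : V} (hu : l1 u = 0) :
    0 ≤ H u u ∧ (H u u = 0 → B1 u u ≠ 0 → H u e = 0) := by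
  obtain ⟨r, hr, hroot⟩ := exists_small_root (B1 e e) (B1 u e) (B1 u u)
  have hid : Tendsto (fun t : ℝ => t) (𝓝 0) (𝓝 0) := tendsto_id
  have hγ : Tendsto (fun t : ℝ => t • u + (t ^ 2 * r t) • e) (𝓝 0) (𝓝 (0:V)) := by
    simpa using (hid.smul_const u).add (((hid.pow 2).mul hr).smul_const e)
  have hcurve : ∀ᶠ t in 𝓝 (0:ℝ),
      0 ≤ t ^ 2 * (H u u + t * (2 * r t * H u e + t * (r t ^ 2 * H e e))) := by
    filter_upwards [hroot, hγ.eventually hloc] with t h1 h2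
    rw [bilin_comb_self hB1, bilin_comb_self hH] at h2
    simp only [map_add, map_smul, smul_eq_mul, hu, he] at h2
    have := h2 (by linear_combination h1)
    linarith
  have hψ : Tendsto (fun t : ℝ => 2 * r t * H u e + t * (r t ^ 2 * H e e)) (𝓝 0)
      (𝓝 (2 * (-B1 u u / 2) * H u e + 0 * ((-B1 u u / 2) ^ 2 * H e e))) :=
    ((hr.const_mul 2).mul_const _).add (hid.mul ((hr.pow 2).mul_const _))
  constructor
  · have := limit_nonneg_of_sq_mul_nonneg ((hid.mul hψ).const_add (H u u)) hcurve
    simpa using this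
  · intro h0 hβ
    have := limit_eq_zero_of_mul_nonneg hψ (by
      filter_upwards [hcurve] with t ht
      rcases eq_or_ne t 0 with rfl | ht0
      · simp
      · rw [h0, zero_add] at ht
        exact nonneg_of_mul_nonneg_right ht (by positivity))
    have h2 : B1 u u * H u e = 0 := by linarith
    exact (mul_eq_zero.mp h2).resolve_left hβ

/-- If the quadratic form `H` has `0` as a strict local minimizer on `B₁ d d + 2 l₁ d = 0`, where
`l₁ ≠ 0`, and takes a negative value somewhere, then it is positive definite on `ker l₁`. -/
lemma pos_of_strict_local_of_neg {H B1 : LinearMap.BilinForm ℝ V} {l1 : V →ₗ[ℝ] ℝ} {e d : V}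
    (hH : ∀ x y, H x y = H y x) (hB1 : ∀ x y, B1 x y = B1 y x) (he : l1 e = 1)
    (hloc : ∀ᶠ d in 𝓝 (0:V), d ≠ 0 → B1 d d + 2 * l1 d = 0 → 0 < H d d)
    (hd : H d d < 0) {v : V} (hv : v ≠ 0) (hlv : l1 v = 0) : 0 < H v v := by
  have hloc' : ∀ᶠ d in 𝓝 (0:V), B1 d d + 2 * l1 d = 0 → 0 ≤ H d d := by
    filter_upwards [hloc] with d h h1
    rcases eq_or_ne d 0 with rfl | hd0
    · simp
    · exact (h hd0 h1).le
  have hpsd : ∀ u, l1 u = 0 → 0 ≤ H u u :=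
    fun u hu => (second_order_necessary hH hB1 he hloc' hu).1
  refine (hpsd v hlv).lt_of_ne' fun hv0 => ?_
  have hβ : B1 v v ≠ 0 := by
    intro hβ
    have hid : Tendsto (fun t : ℝ => t • v) (𝓝[>] 0) (𝓝 (0:V)) := by
      have : Tendsto (fun t : ℝ => t) (𝓝[>] 0) (𝓝 0) :=
        tendsto_id.mono_left nhdsWithin_le_nhds
      simpa using this.smul_const v
    obtain ⟨t, ht, ht0⟩ := ((hid.eventually hloc).and self_mem_nhdsWithin).exists
    have := ht (smul_ne_zero (ne_of_gt ht0) hv) (by simp [hβ, hlv])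
    simp [hv0] at this
  have hve : H v e = 0 := (second_order_necessary hH hB1 he hloc' hlv).2 hv0 hβ
  have hvw : ∀ w, l1 w = 0 → H w v = 0 := by
    intro w hw
    by_contra hne
    have h := hpsd ((1:ℝ) • w + (-(H w w + 1) / (2 * H w v)) • v) (by simp [hw, hlv])
    rw [bilin_comb_self hH, hv0] at h
    have := div_mul_cancel₀ (-(H w w + 1)) (mul_ne_zero two_ne_zero hne)
    linarith
  have hdv : H d v = 0 := by
    have := hvw (d - l1 d • e) (by simp [he])
    simpa [hH e v, hve] using this
  have hk : l1 d ≠ 0 := fun hk => absurd (hpsd d hk) (not_le.mpr hd)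
  obtain ⟨d', hd', hdv', hsign⟩ : ∃ d', H d' d' < 0 ∧ H d' v = 0 ∧ B1 v v * l1 d' < 0 := by
    rcases lt_or_gt_of_ne (mul_ne_zero hβ hk) with h | h
    · exact ⟨d, hd, hdv, h⟩
    · exact ⟨-d, by simpa using hd, by simpa using hdv, by simpa using h⟩
  obtain ⟨σ, hσ, hroot⟩ := exists_vanishing_root (a := B1 d' d') (b := B1 d' v) hsign
  have hγ : Tendsto (fun t : ℝ => t • d' + σ t • v) (𝓝[>] 0) (𝓝 (0:V)) := by
    have : Tendsto (fun t : ℝ => t) (𝓝[>] 0) (𝓝 0) :=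
      tendsto_id.mono_left nhdsWithin_le_nhds
    simpa using (this.smul_const d').add (hσ.smul_const v)
  obtain ⟨t, ⟨h1, h2⟩, ht0⟩ :=
    ((hroot.and (hγ.eventually hloc')).and self_mem_nhdsWithin).exists
  rw [bilin_comb_self hB1, bilin_comb_self hH] at h2
  simp only [map_add, map_smul, smul_eq_mul, hlv, hv0, hdv'] at h2
  have h3 := h2 (by linear_combination h1)
  have ht2 : 0 < t ^ 2 := pow_pos ht0 2
  nlinarith [mul_neg_of_pos_of_neg ht2 hd']

/-- Second-order sufficient conditions at a strict local minimizer `0` of `B₀ d d + 2 l₀ d` on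
`B₁ d d + 2 l₁ d = 0` which is beaten by a point `d` at which the Lagrangian is negative. -/
lemma second_order_sufficient {B0 B1 : LinearMap.BilinForm ℝ V} {l0 l1 : V →ₗ[ℝ] ℝ} {e d : V}
    (hB0 : ∀ x y, B0 x y = B0 y x) (hB1 : ∀ x y, B1 x y = B1 y x) (he : l1 e = 1)
    (hloc : ∀ᶠ d in 𝓝 (0:V), d ≠ 0 → B1 d d + 2 * l1 d = 0 → 0 < B0 d d + 2 * l0 d)
    (hd : B0 d d + 2 * l0 d < 0) (hd1 : 0 ≤ l0 e * (B1 d d + 2 * l1 d)) :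
    (∀ x, l0 x = l0 e * l1 x) ∧
      ∀ v, v ≠ 0 → l1 v = 0 → 0 < B0 v v - l0 e * B1 v v := by
  have hkkt : ∀ x, l0 x = l0 e * l1 x := by
    refine first_order_necessary hB0 hB1 he ?_
    filter_upwards [hloc] with d h h1
    rcases eq_or_ne d 0 with rfl | hd0
    · simp
    · exact (h hd0 h1).le
  refine ⟨hkkt, fun v hv hlv => ?_⟩
  have := pos_of_strict_local_of_neg (H := B0 - l0 e • B1) (B1 := B1) (l1 := l1) (d := d)
    (fun x y => by simp [hB0 x y, hB1 x y]) hB1 he ?_ ?_ hv hlv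
  · simpa using this
  · filter_upwards [hloc] with x hx hx0 hx1
    have h := hx hx0 hx1
    rw [hkkt x] at h
    simp only [LinearMap.sub_apply, LinearMap.smul_apply, smul_eq_mul]
    linear_combination h + l0 e * hx1
  · rw [hkkt d] at hd
    simp only [LinearMap.sub_apply, LinearMap.smul_apply, smul_eq_mul]
    linarith

end Quadratic

lemma continuous_euclNorm {n : ℕ} : Continuous (euclNorm (n := n)) := by
  unfold euclNorm dotProduct
  fun_prop

lemma eventually_of_euclNorm_sub_lt {n : ℕ} {xs : Fin n → ℝ} {δ : ℝ} (hδ : 0 < δ) :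
    ∀ᶠ d in 𝓝 (0 : Fin n → ℝ), euclNorm (xs + d - xs) < δ := by
  have h := (continuous_euclNorm (n := n)).tendsto 0
  simp only [add_sub_cancel_left]
  exact h.eventually_lt_const (by simpa [euclNorm] using hδ)

lemma quadratic_add {n : ℕ} {A : Matrix (Fin n) (Fin n) ℝ} (hA : A.IsSymm)
    (b x d : Fin n → ℝ) :
    (x + d) ⬝ᵥ A.mulVec (x + d) + 2 * (b ⬝ᵥ (x + d)) =
      x ⬝ᵥ A.mulVec x + 2 * (b ⬝ᵥ x) +
        (Matrix.toBilin' A d d + 2 * ((A.mulVec x + b) ⬝ᵥ d)) := by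
  have h : x ⬝ᵥ A.mulVec d = A.mulVec x ⬝ᵥ d := by
    rw [dotProduct_mulVec, ← mulVec_transpose, hA.eq]
  simp only [Matrix.toBilin'_apply', mulVec_add, dotProduct_add, add_dotProduct, h,
    dotProduct_comm d (A.mulVec x)]
  ring

lemma toBilin'_symm {n : ℕ} {A : Matrix (Fin n) (Fin n) ℝ} (hA : A.IsSymm)
    (x y : Fin n → ℝ) : Matrix.toBilin' A x y = Matrix.toBilin' A y x := by
  rw [Matrix.toBilin'_apply', Matrix.toBilin'_apply', dotProduct_mulVec, ← mulVec_transpose,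
    hA.eq, dotProduct_comm]

lemma qf0_add {n : ℕ} {A : Matrix (Fin n) (Fin n) ℝ} (hA : A.IsSymm) (b x d : Fin n → ℝ) :
    qf0 A b (x + d) =
      qf0 A b x + (Matrix.toBilin' A d d + 2 * ((A.mulVec x + b) ⬝ᵥ d)) :=
  quadratic_add hA b x d

lemma qf1_add {n : ℕ} {A : Matrix (Fin n) (Fin n) ℝ} (hA : A.IsSymm) (b : Fin n → ℝ) (c : ℝ)
    (x d : Fin n → ℝ) :
    qf1 A b c (x + d) =
      qf1 A b c x + (Matrix.toBilin' A d d + 2 * ((A.mulVec x + b) ⬝ᵥ d)) := by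
  rw [qf1, qf1, quadratic_add hA b x d]
  ring

section LocalMinimizer

variable {n : ℕ} {A0 A1 : Matrix (Fin n) (Fin n) ℝ} {b0 b1 : Fin n → ℝ} {c1 : ℝ}
  {xs : Fin n → ℝ}

lemma IsStrictLocalMinGTRE.eventually (h : IsStrictLocalMinGTRE A0 A1 b0 b1 c1 xs) :
    ∀ᶠ d in 𝓝 (0 : Fin n → ℝ),
      d ≠ 0 → qf1 A1 b1 c1 (xs + d) = 0 → qf0 A0 b0 xs < qf0 A0 b0 (xs + d) := by
  obtain ⟨-, δ, hδ, h⟩ := h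
  filter_upwards [eventually_of_euclNorm_sub_lt hδ] with d hd hd0 h1
  exact h _ h1 (by simpa using hd0) hd

lemma IsStrictLocalMinGTR.eventually (h : IsStrictLocalMinGTR A0 A1 b0 b1 c1 xs) :
    ∀ᶠ d in 𝓝 (0 : Fin n → ℝ),
      d ≠ 0 → qf1 A1 b1 c1 (xs + d) ≤ 0 → qf0 A0 b0 xs < qf0 A0 b0 (xs + d) := by
  obtain ⟨-, δ, hδ, h⟩ := h
  filter_upwards [eventually_of_euclNorm_sub_lt hδ] with d hd hd0 h1
  exact h _ h1 (by simpa using hd0) hd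

/-- A strict local minimizer over the points satisfying `P` is no worse than `xs + d` if `P` holds
at all points of the line through `xs` and `xs + d` close to `xs`. -/
lemma qf0_le_of_line_feasible (hA0 : A0.IsSymm) {P : (Fin n → ℝ) → Prop}
    (hloc : ∀ᶠ d in 𝓝 (0 : Fin n → ℝ),
      d ≠ 0 → P (xs + d) → qf0 A0 b0 xs < qf0 A0 b0 (xs + d))
    {d : Fin n → ℝ} (hP : ∀ᶠ t in 𝓝 (0:ℝ), P (xs + t • d)) :
    qf0 A0 b0 xs ≤ qf0 A0 b0 (xs + d) := by
  have hline : Tendsto (fun t : ℝ => t • d) (𝓝 0) (𝓝 0) := by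
    simpa using (tendsto_id (x := 𝓝 (0:ℝ))).smul_const d
  have := quadratic_nonneg_of_eventually (q := Matrix.toBilin' A0 d d)
    (l := (A0.mulVec xs + b0) ⬝ᵥ d) (by
      filter_upwards [hP, hline.eventually hloc] with t h1 h2
      rcases eq_or_ne (t • d) 0 with h0 | h0
      · rcases smul_eq_zero.mp h0 with h0 | h0 <;> simp [h0]
      · have h3 := h2 h0 h1
        rw [qf0_add hA0] at h3
        simp only [map_smul, LinearMap.smul_apply, smul_eq_mul, dotProduct_smul] at h3
        linarith)
  rw [qf0_add hA0]
  linarith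

/-- The second-order sufficient conditions at a strict local minimizer on the boundary of the
constraint where the constraint gradient does not vanish. -/
lemma exists_multiplier (hA0 : A0.IsSymm) (hA1 : A1.IsSymm)
    (hg : A1.mulVec xs + b1 ≠ 0) (hact : qf1 A1 b1 c1 xs = 0)
    (hloc : ∀ᶠ d in 𝓝 (0 : Fin n → ℝ),
      d ≠ 0 → qf1 A1 b1 c1 (xs + d) = 0 → qf0 A0 b0 xs < qf0 A0 b0 (xs + d))
    {d : Fin n → ℝ} (hd : qf0 A0 b0 (xs + d) < qf0 A0 b0 xs)
    (hd1 : 0 ≤ ((A0.mulVec xs + b0) ⬝ᵥ (A1.mulVec xs + b1)) * qf1 A1 b1 c1 (xs + d)) :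
    ∃ μ : ℝ,
      (A0.mulVec xs + b0) + μ • (A1.mulVec xs + b1) = 0 ∧
      (∀ v : Fin n → ℝ, v ≠ 0 → (A1.mulVec xs + b1) ⬝ᵥ v = 0 →
        0 < v ⬝ᵥ (A0 + μ • A1).mulVec v) := by
  simp only [qf0_add hA0, qf1_add hA1, hact, zero_add] at hloc hd hd1
  set g0 := A0.mulVec xs + b0
  set g1 := A1.mulVec xs + b1
  have hG : 0 < g1 ⬝ᵥ g1 :=
    lt_of_le_of_ne (by simpa using dotProduct_star_self_nonneg g1)
      (Ne.symm (by simpa [dotProduct_self_eq_zero] using hg))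
  have hl (g x : Fin n → ℝ) : dotProductBilin ℝ ℝ g x = g ⬝ᵥ x := rfl
  obtain ⟨hkkt, hpos⟩ := second_order_sufficient (B0 := Matrix.toBilin' A0)
    (B1 := Matrix.toBilin' A1) (l0 := dotProductBilin ℝ ℝ g0) (l1 := dotProductBilin ℝ ℝ g1)
    (e := (g1 ⬝ᵥ g1)⁻¹ • g1) (d := d) (toBilin'_symm hA0) (toBilin'_symm hA1)
    (by simp [hl, hG.ne'])
    (by
      filter_upwards [hloc] with x hx hx0 hx1
      have := hx hx0 hx1
      simp only [hl]
      linarith)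
    (by simp only [hl]; linarith)
    (by
      simp only [hl, dotProduct_smul, smul_eq_mul, mul_assoc]
      exact mul_nonneg (inv_nonneg.mpr hG.le) hd1)
  simp only [hl] at hkkt hpos
  refine ⟨-(g0 ⬝ᵥ ((g1 ⬝ᵥ g1)⁻¹ • g1)), ?_, fun v hv hv1 => ?_⟩
  · refine dotProduct_eq_zero _ fun x => ?_
    rw [add_dotProduct, smul_dotProduct, hkkt x, smul_eq_mul]
    ring
  · have := hpos v hv hv1
    simp only [Matrix.toBilin'_apply', dotProduct_smul, smul_eq_mul] at this
    simp only [add_mulVec, smul_mulVec, dotProduct_add, dotProduct_smul, smul_eq_mul]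
    linarith

/-- At a strict local minimizer of (GTR) on the boundary, the gradients of the objective and of
the constraint do not form an acute angle. -/
lemma gradients_dotProduct_nonpos (hA0 : A0.IsSymm) (hA1 : A1.IsSymm)
    (hg : A1.mulVec xs + b1 ≠ 0) (hact : qf1 A1 b1 c1 xs = 0)
    (hloc : ∀ᶠ d in 𝓝 (0 : Fin n → ℝ),
      d ≠ 0 → qf1 A1 b1 c1 (xs + d) ≤ 0 → qf0 A0 b0 xs < qf0 A0 b0 (xs + d)) :
    (A0.mulVec xs + b0) ⬝ᵥ (A1.mulVec xs + b1) ≤ 0 := by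
  simp only [qf0_add hA0, qf1_add hA1, hact, zero_add] at hloc
  set g0 := A0.mulVec xs + b0
  set g1 := A1.mulVec xs + b1
  have hG : 0 < g1 ⬝ᵥ g1 :=
    lt_of_le_of_ne (by simpa using dotProduct_star_self_nonneg g1)
      (Ne.symm (by simpa [dotProduct_self_eq_zero] using hg))
  have hid : Tendsto (fun t : ℝ => t) (𝓝[>] 0) (𝓝 0) :=
    tendsto_id.mono_left nhdsWithin_le_nhds
  have hline : Tendsto (fun t : ℝ => (-t) • g1) (𝓝[>] 0) (𝓝 0) := by
    simpa using hid.neg.smul_const g1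
  have hcon : Tendsto (fun t : ℝ => t * Matrix.toBilin' A1 g1 g1 - 2 * (g1 ⬝ᵥ g1)) (𝓝[>] 0)
      (𝓝 (0 * Matrix.toBilin' A1 g1 g1 - 2 * (g1 ⬝ᵥ g1))) :=
    (hid.mul_const _).sub_const _
  have hobj : Tendsto (fun t : ℝ => t * Matrix.toBilin' A0 g1 g1 - 2 * (g0 ⬝ᵥ g1)) (𝓝[>] 0)
      (𝓝 (0 * Matrix.toBilin' A0 g1 g1 - 2 * (g0 ⬝ᵥ g1))) :=
    (hid.mul_const _).sub_const _
  have := ge_of_tendsto hobj (b := 0) (by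
    filter_upwards [hline.eventually hloc, self_mem_nhdsWithin,
      hcon.eventually_lt_const
        (show 0 * Matrix.toBilin' A1 g1 g1 - 2 * (g1 ⬝ᵥ g1) < 0 by linarith)]
      with t h1 (ht : 0 < t) h2
    simp only [map_smul, LinearMap.smul_apply, smul_eq_mul, dotProduct_smul] at h1
    have h3 := h1 (smul_ne_zero (neg_ne_zero.mpr ht.ne') hg) (by nlinarith)
    exact nonneg_of_mul_nonneg_right (a := t) (by nlinarith) ht)
  linarith

end LocalMinimizer

theorem stmt6 {n : ℕ} (hn : 1 ≤ n)
    (A0 A1 : Matrix (Fin n) (Fin n) ℝ) (hA0 : A0.IsSymm) (hA1 : A1.IsSymm)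
    (b0 b1 : Fin n → ℝ) (c1 : ℝ) (xs : Fin n → ℝ)
    (hx : IsStrictLNGMinGTRE A0 A1 b0 b1 c1 xs ∨ IsStrictLNGMinGTR A0 A1 b0 b1 c1 xs) :
    ∃ μ : ℝ,
      (A0.mulVec xs + b0) + μ • (A1.mulVec xs + b1) = 0 ∧
      (∀ v : Fin n → ℝ, v ≠ 0 → (A1.mulVec xs + b1) ⬝ᵥ v = 0 →
        0 < v ⬝ᵥ (A0 + μ • A1).mulVec v) := by
  rcases hx with ⟨hloc, hng⟩ | ⟨hloc, hng⟩
  · have hact := hloc.1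
    have hev := hloc.eventually
    simp only [IsGlobalMinGTRE, hact, true_and, not_forall, not_le] at hng
    obtain ⟨y, hy1, hy⟩ := hng
    obtain ⟨d, rfl⟩ : ∃ d, y = xs + d := ⟨y - xs, by simp⟩
    refine exists_multiplier hA0 hA1 (fun hg => ?_) hact hev hy (by rw [hy1, mul_zero])
    refine absurd (qf0_le_of_line_feasible (P := fun x => qf1 A1 b1 c1 x = 0) hA0 hev
      (Eventually.of_forall fun t => ?_)) (not_le.mpr hy)
    rw [qf1_add hA1, hact, hg] at hy1 ⊢
    simp only [zero_dotProduct, mul_zero, add_zero, zero_add] at hy1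
    simp [hy1]
  · have hfeas := hloc.1
    have hev := hloc.eventually
    simp only [IsGlobalMinGTR, hfeas, true_and, not_forall, not_le] at hng
    obtain ⟨y, hy1, hy⟩ := hng
    obtain ⟨d, rfl⟩ : ∃ d, y = xs + d := ⟨y - xs, by simp⟩
    have hact : qf1 A1 b1 c1 xs = 0 := by
      refine hfeas.antisymm (not_lt.mp fun hlt => ?_)
      have hcont : Continuous fun t : ℝ => qf1 A1 b1 c1 (xs + t • d) := by
        simp only [qf1_add hA1, map_smul, LinearMap.smul_apply, dotProduct_smul, smul_eq_mul]
        fun_prop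
      have h0 := hcont.tendsto 0
      simp only [zero_smul, add_zero] at h0
      exact absurd (qf0_le_of_line_feasible (P := fun x => qf1 A1 b1 c1 x ≤ 0) hA0 hev
        ((h0.eventually_lt_const hlt).mono fun _ h => h.le)) (not_le.mpr hy)
    have hg : A1.mulVec xs + b1 ≠ 0 := by
      intro hg
      refine absurd (qf0_le_of_line_feasible (P := fun x => qf1 A1 b1 c1 x ≤ 0) hA0 hev
        (Eventually.of_forall fun t => ?_)) (not_le.mpr hy)
      rw [qf1_add hA1, hact, hg] at hy1 ⊢
      simp only [zero_dotProduct, mul_zero, add_zero, zero_add] at hy1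
      simp only [map_smul, LinearMap.smul_apply, smul_eq_mul, zero_dotProduct, mul_zero,
        add_zero, zero_add, ← mul_assoc]
      exact mul_nonpos_of_nonneg_of_nonpos (mul_self_nonneg t) hy1
    exact exists_multiplier hA0 hA1 hg hact
      (hev.mono fun x h h0 h1 => h h0 h1.le) hy
      (mul_nonneg_of_nonpos_of_nonpos
        (gradients_dotProduct_nonpos hA0 hA1 hg hact hev) hy1)
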